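/- arXiv:1804.06663 — 2 statements merged into one kernel-verified Lean document; each statement's English description precedes it below -/
import Mathlib

section
/- Let ξ ∈ D(v,d,m) be an exact block design satisfying 2·ξ(0,k) = m_k for every block k = 1,…,d (so every block size m_k is even and half of each block is assigned to the control) and r_1(ξ) = r_2(ξ) = … = r_v(ξ). Then ξ is E-optimal in D(v,d,m) (it maximizes λ_min(N(η)) over all η ∈ D(v,d,m)); moreover, ξ minimizes 1_v^T N(η)^{−1} 1_v over all feasible η ∈ D(v,d,m), and ξ minimizes Σ_{i=1}^v (N(η)^{−1})_{ii} + Σ_{1 ≤ i ≠ j ≤ v} |(N(η)^{−1})_{ij}| over all feasible η ∈ D(v,d,m). -/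
open Matrix BigOperators Finset

/-- An exact block design in `D(v,d,m)`: `v` test treatments (labelled `1,…,v`, with
treatment `0` the control), `d` blocks of sizes `m_1,…,m_d`; `w i k` is the number of
trials of treatment `i` in block `k`. -/
structure ExactDesign (v d : ℕ) (m : Fin d → ℕ) where
  w : Fin (v + 1) → Fin d → ℕ
  block_sum : ∀ k, ∑ i, w i k = m k

namespace ExactDesign

variable {v d : ℕ} {m : Fin d → ℕ}

/-- Treatment replications `r_i(ξ)`. -/
def r (ξ : ExactDesign v d m) (i : Fin (v + 1)) : ℕ := ∑ k, ξ.w i k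

/-- Concurrences `μ_{ij}(ξ) = Σ_k ξ(i,k) ξ(j,k)`. -/
def mu (ξ : ExactDesign v d m) (i j : Fin (v + 1)) : ℕ := ∑ k, ξ.w i k * ξ.w j k

/-- The information matrix `N(ξ) = diag(r_1,…,r_v) − Z diag(m⁻¹) Zᵀ` for comparing
the test treatments with the control. -/
noncomputable def N (ξ : ExactDesign v d m) : Matrix (Fin v) (Fin v) ℝ :=
  Matrix.of fun i j =>
    (if i = j then (ξ.r i.succ : ℝ) else 0)
      - ∑ k, (ξ.w i.succ k : ℝ) * (ξ.w j.succ k : ℝ) / (m k : ℝ)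

end ExactDesign

/-- The smallest eigenvalue of a real matrix, as the infimum of its spectrum. -/
noncomputable def lamMin {n : ℕ} (A : Matrix (Fin n) (Fin n) ℝ) : ℝ :=
  sInf (spectrum ℝ A)

/-- The sum of the variances plus the sum of absolute values of the covariances of
the treatment-control contrast estimators: `Σ_i (A⁻¹)_{ii} + Σ_{i ≠ j} |(A⁻¹)_{ij}|`. -/
noncomputable def varCovSum {n : ℕ} (A : Matrix (Fin n) (Fin n) ℝ) : ℝ :=
  ∑ i, A⁻¹ i i + ∑ i, ∑ j, if i = j then 0 else |A⁻¹ i j|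

/-- An eigenvalue of `A` lies in the spectrum of `A`. -/
theorem Matrix.mem_spectrum_of_mulVec_eq_smul {n : ℕ} {A : Matrix (Fin n) (Fin n) ℝ}
    {x : Fin n → ℝ} {c : ℝ} (hx : x ≠ 0) (h : A *ᵥ x = c • x) : c ∈ spectrum ℝ A := by
  rw [spectrum.mem_iff]
  intro hu
  have hdet := (Matrix.isUnit_iff_isUnit_det _).mp hu
  have h0 : (algebraMap ℝ (Matrix (Fin n) (Fin n) ℝ) c - A) *ᵥ x = 0 := by
    rw [Matrix.sub_mulVec, h, Algebra.algebraMap_eq_smul_one, Matrix.smul_mulVec,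
      Matrix.one_mulVec, sub_self]
  exact hx (Matrix.eq_zero_of_mulVec_eq_zero hdet.ne_zero h0)

/-- The smallest eigenvalue of a symmetric matrix bounds its quadratic form from below. -/
theorem lamMin_mul_le_dotProduct_mulVec {n : ℕ} {A : Matrix (Fin n) (Fin n) ℝ}
    (hA : A.IsHermitian) (x : Fin n → ℝ) : lamMin A * (x ⬝ᵥ x) ≤ x ⬝ᵥ (A *ᵥ x) := by
  have hbdd : BddBelow (spectrum ℝ A) := (Matrix.finite_real_spectrum (A := A)).bddBelow
  have hpsd : (A - algebraMap ℝ (Matrix (Fin n) (Fin n) ℝ) (lamMin A)).PosSemidef := by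
    rw [Matrix.posSemidef_iff_isHermitian_and_spectrum_nonneg]
    refine ⟨hA.sub ?_, ?_⟩
    · rw [Algebra.algebraMap_eq_smul_one]
      simp [Matrix.IsHermitian]
    · intro a ha
      rw [← spectrum.sub_singleton_eq] at ha
      obtain ⟨b, hb, c, rfl, rfl⟩ := Set.mem_sub.mp ha
      exact sub_nonneg.mpr (csInf_le hbdd hb)
  have h := hpsd.dotProduct_mulVec_nonneg x
  rw [Matrix.sub_mulVec, Algebra.algebraMap_eq_smul_one, Matrix.smul_mulVec,
    Matrix.one_mulVec, star_trivial, dotProduct_sub, dotProduct_smul, smul_eq_mul] at h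
  linarith

/-- An eigenvalue of `A` that bounds the quadratic form of `A` from below is the smallest one. -/
theorem lamMin_eq_of_mulVec_eq_smul {n : ℕ} {A : Matrix (Fin n) (Fin n) ℝ}
    {x : Fin n → ℝ} {c : ℝ} (hx : x ≠ 0) (h : A *ᵥ x = c • x)
    (hq : ∀ y : Fin n → ℝ, c * (y ⬝ᵥ y) ≤ y ⬝ᵥ (A *ᵥ y)) : lamMin A = c := by
  refine IsLeast.csInf_eq ⟨Matrix.mem_spectrum_of_mulVec_eq_smul hx h, fun b hb => ?_⟩
  rw [← Matrix.spectrum_toLin', ← Module.End.hasEigenvalue_iff_mem_spectrum] at hb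
  obtain ⟨y, hy⟩ := hb.exists_hasEigenvector
  have hAy : A *ᵥ y = b • y := by simpa using hy.apply_eq_smul
  have hle := hq y
  rw [hAy, dotProduct_smul, smul_eq_mul] at hle
  have hpos : 0 < y ⬝ᵥ y := by simpa using Matrix.dotProduct_star_self_pos_iff.mpr hy.2
  exact le_of_mul_le_mul_right hle hpos

/-- A lower bound for the quadratic form of the inverse of a positive definite matrix, obtained
from `0 ≤ (A⁻¹ x - t x)ᵀ A (A⁻¹ x - t x)`. -/
theorem Matrix.PosDef.le_dotProduct_inv_mulVec {n : ℕ} {A : Matrix (Fin n) (Fin n) ℝ}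
    (hA : A.PosDef) (x : Fin n → ℝ) (t : ℝ) :
    2 * t * (x ⬝ᵥ x) - t ^ 2 * (x ⬝ᵥ (A *ᵥ x)) ≤ x ⬝ᵥ (A⁻¹ *ᵥ x) := by
  have hdet : IsUnit A.det := hA.det_pos.ne'.isUnit
  have hAy : A *ᵥ (A⁻¹ *ᵥ x) = x := by
    rw [Matrix.mulVec_mulVec, Matrix.mul_nonsing_inv A hdet, Matrix.one_mulVec]
  have hT : Aᵀ = A := by simpa [Matrix.conjTranspose_eq_transpose_of_trivial] using hA.1.eq
  have hsymm : (A⁻¹ *ᵥ x) ⬝ᵥ (A *ᵥ x) = x ⬝ᵥ x := by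
    rw [dotProduct_mulVec, ← mulVec_transpose, hT, hAy]
  have h := hA.posSemidef.dotProduct_mulVec_nonneg (A⁻¹ *ᵥ x - t • x)
  rw [star_trivial, mulVec_sub, mulVec_smul, hAy, sub_dotProduct, dotProduct_sub, dotProduct_sub,
    smul_dotProduct, smul_dotProduct, dotProduct_smul, dotProduct_smul, hsymm,
    dotProduct_comm (A⁻¹ *ᵥ x) x] at h
  simp only [smul_eq_mul] at h
  linarith

/-- A matrix with nonpositive off-diagonal entries and constant positive row sums is
inverse-nonnegative. -/
theorem nonneg_of_mulVec_nonneg {n : ℕ} {A : Matrix (Fin n) (Fin n) ℝ} {c : ℝ} (hc : 0 < c)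
    (hoff : ∀ i j, i ≠ j → A i j ≤ 0) (hrow : ∀ i, ∑ j, A i j = c)
    {x : Fin n → ℝ} (hx : ∀ i, 0 ≤ (A *ᵥ x) i) (i : Fin n) : 0 ≤ x i := by
  have : Nonempty (Fin n) := ⟨i⟩
  obtain ⟨a, ha⟩ := Finite.exists_min x
  refine le_trans ?_ (ha i)
  have h : (A *ᵥ x) a ≤ c * x a := by
    rw [← hrow a, Finset.sum_mul, mulVec, dotProduct]
    refine Finset.sum_le_sum fun j _ => ?_
    rcases eq_or_ne a j with rfl | hj
    · exact le_rfl
    · exact mul_le_mul_of_nonpos_left (ha j) (hoff a j hj)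
  exact nonneg_of_mul_nonneg_right ((hx a).trans h) hc

theorem ones_dotProduct_mulVec_ones {n : ℕ} (A : Matrix (Fin n) (Fin n) ℝ) :
    (fun _ => (1 : ℝ)) ⬝ᵥ (A *ᵥ fun _ => (1 : ℝ)) = ∑ i, ∑ j, A i j := by
  simp [dotProduct, mulVec]

theorem varCovSum_eq {n : ℕ} (A : Matrix (Fin n) (Fin n) ℝ) :
    varCovSum A = ∑ i, ∑ j, if i = j then A⁻¹ i j else |A⁻¹ i j| := by
  rw [varCovSum, ← Finset.sum_add_distrib]
  refine Finset.sum_congr rfl fun i _ => ?_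
  rw [← Fintype.sum_ite_eq i fun j => A⁻¹ i j, ← Finset.sum_add_distrib]
  refine Finset.sum_congr rfl fun j _ => ?_
  split_ifs <;> simp

theorem ones_dotProduct_inv_mulVec_ones_le_varCovSum {n : ℕ} (A : Matrix (Fin n) (Fin n) ℝ) :
    (fun _ => (1 : ℝ)) ⬝ᵥ (A⁻¹ *ᵥ fun _ => (1 : ℝ)) ≤ varCovSum A := by
  rw [ones_dotProduct_mulVec_ones, varCovSum_eq]
  refine Finset.sum_le_sum fun i _ => ?_
  refine Finset.sum_le_sum fun j _ => ?_
  split_ifs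
  · exact le_rfl
  · exact le_abs_self _

theorem varCovSum_eq_of_inv_nonneg {n : ℕ} {A : Matrix (Fin n) (Fin n) ℝ}
    (h : ∀ i j, 0 ≤ A⁻¹ i j) :
    varCovSum A = (fun _ => (1 : ℝ)) ⬝ᵥ (A⁻¹ *ᵥ fun _ => (1 : ℝ)) := by
  rw [ones_dotProduct_mulVec_ones, varCovSum_eq]
  refine Finset.sum_congr rfl fun i _ => Finset.sum_congr rfl fun j _ => ?_
  rw [abs_of_nonneg (h i j), ite_self]

namespace ExactDesign

variable {v d : ℕ} {m : Fin d → ℕ}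

theorem N_isHermitian (η : ExactDesign v d m) : η.N.IsHermitian := by
  ext i j
  simp only [N, conjTranspose_apply, of_apply, star_trivial]
  congr 1
  · rcases eq_or_ne i j with rfl | h
    · rfl
    · simp [h, h.symm]
  · exact Finset.sum_congr rfl fun k _ => by rw [mul_comm (η.w j.succ k : ℝ)]

theorem sum_succ (η : ExactDesign v d m) (k : Fin d) :
    ∑ i : Fin v, (η.w i.succ k : ℝ) = m k - η.w 0 k := by
  have h : ∑ i, (η.w i k : ℝ) = m k := mod_cast η.block_sum k
  rw [Fin.sum_univ_succ] at h
  linarith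

theorem N_mulVec_apply (η : ExactDesign v d m) (x : Fin v → ℝ) (i : Fin v) :
    (η.N *ᵥ x) i =
      ∑ k, η.w i.succ k * (x i - (∑ j, η.w j.succ k * x j) / m k) := by
  simp only [mulVec, dotProduct, N, of_apply, sub_mul, Finset.sum_sub_distrib, mul_sub,
    ite_mul, zero_mul, Finset.sum_ite_eq, Finset.mem_univ, if_true, r, Nat.cast_sum,
    Finset.sum_mul]
  congr 1
  rw [Finset.sum_comm]
  refine Finset.sum_congr rfl fun k _ => ?_
  rw [Finset.sum_div, Finset.mul_sum]
  exact Finset.sum_congr rfl fun j _ => by ring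

theorem sum_N_row (η : ExactDesign v d m) (hm : ∀ k, 0 < m k) (i : Fin v) :
    ∑ j, η.N i j = ∑ k, (η.w i.succ k : ℝ) * (η.w 0 k / m k) := by
  have h := η.N_mulVec_apply (fun _ => 1) i
  simp only [mul_one, sum_succ] at h
  simp only [mulVec, dotProduct, mul_one] at h
  rw [h]
  refine Finset.sum_congr rfl fun k _ => ?_
  have : (m k : ℝ) ≠ 0 := mod_cast (hm k).ne'
  field_simp
  ring

theorem sum_N_le (η : ExactDesign v d m) (hm : ∀ k, 0 < m k) :
    ∑ i, ∑ j, η.N i j ≤ ∑ k, (m k : ℝ) / 4 := by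
  simp only [η.sum_N_row hm]
  rw [Finset.sum_comm]
  refine Finset.sum_le_sum fun k _ => ?_
  have : (0 : ℝ) < m k := mod_cast hm k
  rw [← Finset.sum_mul, sum_succ, ← mul_div_assoc, div_le_iff₀ this]
  nlinarith [sq_nonneg ((m k : ℝ) - 2 * η.w 0 k)]

theorem dotProduct_N_mulVec (η : ExactDesign v d m) (x : Fin v → ℝ) :
    x ⬝ᵥ (η.N *ᵥ x) = ∑ k, (∑ i : Fin v, (η.w i.succ k : ℝ) * x i ^ 2 -
      (∑ i, (η.w i.succ k : ℝ) * x i) ^ 2 / m k) := by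
  simp only [dotProduct, N_mulVec_apply, Finset.mul_sum]
  rw [Finset.sum_comm]
  refine Finset.sum_congr rfl fun k _ => ?_
  rw [sq (∑ i, (η.w i.succ k : ℝ) * x i), mul_div_assoc, Finset.sum_mul, ← Finset.sum_sub_distrib]
  exact Finset.sum_congr rfl fun i _ => by ring

theorem N_offDiag_nonpos (η : ExactDesign v d m) (i j : Fin v) (hij : i ≠ j) : η.N i j ≤ 0 := by
  simp only [N, of_apply, if_neg hij, zero_sub, neg_nonpos]
  exact Finset.sum_nonneg fun k _ => by positivity

/-- If half of every block is assigned to the control, the quadratic form of the information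
matrix dominates half of that of the replication matrix. -/
theorem half_sum_r_mul_sq_le (ξ : ExactDesign v d m) (hm : ∀ k, 0 < m k)
    (h0 : ∀ k, 2 * ξ.w 0 k = m k) (x : Fin v → ℝ) :
    ∑ i : Fin v, (ξ.r i.succ : ℝ) / 2 * x i ^ 2 ≤ x ⬝ᵥ (ξ.N *ᵥ x) := by
  rw [dotProduct_N_mulVec]
  simp only [r, Nat.cast_sum, Finset.sum_div, Finset.sum_mul]
  rw [Finset.sum_comm]
  refine Finset.sum_le_sum fun k _ => ?_
  have hpos : (0 : ℝ) < m k := mod_cast hm k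
  have h0k : 2 * (ξ.w 0 k : ℝ) = m k := mod_cast h0 k
  have hcs : (∑ i : Fin v, (ξ.w i.succ k : ℝ) * x i) ^ 2 ≤
      (∑ i : Fin v, (ξ.w i.succ k : ℝ)) * ∑ i : Fin v, (ξ.w i.succ k : ℝ) * x i ^ 2 :=
    Finset.sum_sq_le_sum_mul_sum_of_sq_le_mul _ (fun i _ => by positivity)
      (fun i _ => by positivity) fun i _ => le_of_eq (by ring)
  rw [sum_succ] at hcs
  have hdiv : (∑ i : Fin v, (ξ.w i.succ k : ℝ) * x i) ^ 2 / m k ≤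
      (∑ i : Fin v, (ξ.w i.succ k : ℝ) * x i ^ 2) / 2 := by
    rw [div_le_iff₀ hpos]
    calc _ ≤ _ := hcs
      _ = _ := by rw [← h0k]; ring
  have hhalf : ∑ i : Fin v, (ξ.w i.succ k : ℝ) / 2 * x i ^ 2 =
      (∑ i : Fin v, (ξ.w i.succ k : ℝ) * x i ^ 2) / 2 := by
    rw [Finset.sum_div]
    exact Finset.sum_congr rfl fun i _ => by ring
  linarith

end ExactDesign

/-- If an exact design `ξ ∈ D(v,d,m)` assigns half of every block to the
control (`2 ξ(0,k) = m_k`) and is equireplicated in the test treatments, then `ξ` is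
E-optimal in `D(v,d,m)`; moreover it is feasible, minimizes `1_vᵀ N⁻¹ 1_v`, and
minimizes the sum of variances plus absolute covariances over all feasible designs. -/
theorem exact_Eopt_unequal_blocks {v d : ℕ} (hv : 2 ≤ v) (hd : 1 ≤ d)
    (m : Fin d → ℕ) (hm : ∀ k, 0 < m k)
    (ξ : ExactDesign v d m)
    (h0 : ∀ k, 2 * ξ.w 0 k = m k)
    (hr : ∀ i j : Fin v, ξ.r i.succ = ξ.r j.succ) :
    (∀ η : ExactDesign v d m, lamMin (ExactDesign.N η) ≤ lamMin (ExactDesign.N ξ)) ∧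
    (ExactDesign.N ξ).PosDef ∧
    (∀ η : ExactDesign v d m, (ExactDesign.N η).PosDef →
      (fun _ => (1 : ℝ)) ⬝ᵥ ((ExactDesign.N ξ)⁻¹ *ᵥ fun _ => (1 : ℝ)) ≤
        (fun _ => (1 : ℝ)) ⬝ᵥ ((ExactDesign.N η)⁻¹ *ᵥ fun _ => (1 : ℝ))) ∧
    (∀ η : ExactDesign v d m, (ExactDesign.N η).PosDef →
      varCovSum (ExactDesign.N ξ) ≤ varCovSum (ExactDesign.N η)) := by
  obtain ⟨i₀⟩ : Nonempty (Fin v) := ⟨⟨0, by omega⟩⟩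
  obtain ⟨k₀⟩ : Nonempty (Fin d) := ⟨⟨0, by omega⟩⟩
  have hv0 : (0 : ℝ) < v := by exact_mod_cast (by omega : 0 < v)
  obtain ⟨c, hcdef⟩ : ∃ c : ℝ, c = (ξ.r i₀.succ : ℝ) / 2 := ⟨_, rfl⟩
  have hr' : ∀ i : Fin v, (ξ.r i.succ : ℝ) / 2 = c := fun i => by rw [hcdef, hr i i₀]
  have hrow : ∀ i, ∑ j, ξ.N i j = c := fun i => by
    rw [ξ.sum_N_row hm, ← hr' i, ExactDesign.r, Nat.cast_sum, Finset.sum_div]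
    refine Finset.sum_congr rfl fun k _ => ?_
    have hpos : (0 : ℝ) < m k := mod_cast hm k
    have h0k : 2 * (ξ.w 0 k : ℝ) = m k := mod_cast h0 k
    have hne : (m k : ℝ) ≠ 0 := hpos.ne'
    field_simp
    rw [← h0k]
    ring
  have hsum : ∑ k, (m k : ℝ) / 4 = v * c := by
    have h1 : ∑ i : Fin v, (ξ.r i.succ : ℝ) / 2 = v * c := by simp [hr']
    rw [← h1]
    simp only [ExactDesign.r, Nat.cast_sum, Finset.sum_div]
    rw [Finset.sum_comm]
    refine Finset.sum_congr rfl fun k _ => ?_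
    have h0k : 2 * (ξ.w 0 k : ℝ) = m k := mod_cast h0 k
    rw [← Finset.sum_div, ξ.sum_succ]
    linarith
  have hc : 0 < c := by
    refine pos_of_mul_pos_right ?_ hv0.le
    rw [← hsum]
    refine Finset.sum_pos (fun k _ => ?_) ⟨k₀, Finset.mem_univ _⟩
    have : (0 : ℝ) < m k := mod_cast hm k
    positivity
  have hq : ∀ x : Fin v → ℝ, c * (x ⬝ᵥ x) ≤ x ⬝ᵥ (ξ.N *ᵥ x) := fun x => by
    refine le_of_eq_of_le ?_ (ξ.half_sum_r_mul_sq_le hm h0 x)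
    simp only [hr', dotProduct, Finset.mul_sum, sq]
  have hpd : ξ.N.PosDef := by
    refine Matrix.PosDef.of_dotProduct_mulVec_pos ξ.N_isHermitian fun x hx => ?_
    have hpos : 0 < x ⬝ᵥ x := by simpa using Matrix.dotProduct_star_self_pos_iff.mpr hx
    exact (mul_pos hc hpos).trans_le (by simpa using hq x)
  have hdet : IsUnit ξ.N.det := hpd.det_pos.ne'.isUnit
  have hones : ξ.N *ᵥ (fun _ => (1 : ℝ)) = c • fun _ => (1 : ℝ) := by
    ext i
    simpa [mulVec, dotProduct] using hrow i
  have hinv : ξ.N⁻¹ *ᵥ (fun _ => (1 : ℝ)) = c⁻¹ • fun _ => (1 : ℝ) := by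
    have h := congrArg (ξ.N⁻¹ *ᵥ ·) hones
    simp only [mulVec_smul, mulVec_mulVec, Matrix.nonsing_inv_mul _ hdet, one_mulVec] at h
    rw [eq_inv_smul_iff₀ hc.ne', ← h]
  have hnorm : (fun _ : Fin v => (1 : ℝ)) ⬝ᵥ (fun _ => (1 : ℝ)) = v := by simp [dotProduct]
  have hle : ∀ η : ExactDesign v d m,
      (fun _ => (1 : ℝ)) ⬝ᵥ (η.N *ᵥ fun _ => (1 : ℝ)) ≤ v * c := fun η => by
    rw [ones_dotProduct_mulVec_ones, ← hsum]
    exact η.sum_N_le hm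
  have hinvle : ∀ η : ExactDesign v d m, η.N.PosDef →
      (fun _ => (1 : ℝ)) ⬝ᵥ (ξ.N⁻¹ *ᵥ fun _ => (1 : ℝ)) ≤
        (fun _ => (1 : ℝ)) ⬝ᵥ (η.N⁻¹ *ᵥ fun _ => (1 : ℝ)) := fun η hη => by
    refine le_trans ?_ (hη.le_dotProduct_inv_mulVec (fun _ => 1) c⁻¹)
    rw [hinv, dotProduct_smul, hnorm, smul_eq_mul]
    have h := mul_le_mul_of_nonneg_left (hle η) (sq_nonneg c⁻¹)
    have h2 : c⁻¹ ^ 2 * (v * c) = c⁻¹ * v := by field_simp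
    linarith
  refine ⟨fun η => ?_, hpd, hinvle, fun η hη => ?_⟩
  · rw [lamMin_eq_of_mulVec_eq_smul (fun h => one_ne_zero (congrFun h i₀)) hones hq]
    have h := (lamMin_mul_le_dotProduct_mulVec η.N_isHermitian fun _ => 1).trans (hle η)
    rw [hnorm, mul_comm (v : ℝ)] at h
    exact le_of_mul_le_mul_right h hv0
  · rw [varCovSum_eq_of_inv_nonneg]
    · exact (hinvle η hη).trans (ones_dotProduct_inv_mulVec_ones_le_varCovSum _)
    · intro i j
      refine nonneg_of_mulVec_nonneg (x := fun i => ξ.N⁻¹ i j) hc ξ.N_offDiag_nonpos hrow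
        (fun a => ?_) i
      have h : (ξ.N *ᵥ fun i => ξ.N⁻¹ i j) a = (ξ.N * ξ.N⁻¹) a j := rfl
      rw [h, Matrix.mul_nonsing_inv _ hdet, one_apply]
      split_ifs <;> norm_num
end

section
/- Let v ≥ 2, let s_1,…,s_d > 0 with Σ_k s_k = 1, and let ξ* be the product design ξ*(i,k) = r*_i s_k with r*_0 = 1/(√v + 1) and r*_i = 1/(√v(√v + 1)) for 1 ≤ i ≤ v (an A-optimal approximate block design for treatment-control comparisons). Then ξ* is R-optimal: it minimizes Π_{i=1}^{v} (N(ξ)^{−1})_{ii} over all feasible approximate block designs ξ. -/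
open Matrix BigOperators Finset

/-- An approximate block design for `v` test treatments (labelled `1,…,v`, with
treatment `0` the control) and `d` blocks: a nonnegative weight function on
treatment-block pairs summing to one, with every block receiving positive mass. -/
structure ApproxDesign (v d : ℕ) where
  w : Fin (v + 1) → Fin d → ℝ
  nonneg : ∀ i k, 0 ≤ w i k
  le_one : ∀ i k, w i k ≤ 1
  sum_one : ∑ i, ∑ k, w i k = 1
  blockPos : ∀ k, 0 < ∑ i, w i k

namespace ApproxDesign

variable {v d : ℕ}

/-- Block sizes `s_k(ξ)`. -/
noncomputable def s (ξ : ApproxDesign v d) (k : Fin d) : ℝ := ∑ i, ξ.w i k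

/-- Treatment replications `r_i(ξ)`. -/
noncomputable def r (ξ : ApproxDesign v d) (i : Fin (v + 1)) : ℝ := ∑ k, ξ.w i k

/-- The information matrix `N(ξ) = diag(r_1,…,r_v) − Z diag(s⁻¹) Zᵀ` for comparing
the test treatments with the control. -/
noncomputable def N (ξ : ApproxDesign v d) : Matrix (Fin v) (Fin v) ℝ :=
  Matrix.of fun i j =>
    (if i = j then ξ.r i.succ else 0) - ∑ k, ξ.w i.succ k * ξ.w j.succ k / ξ.s k

end ApproxDesign

/-- Cauchy–Schwarz bound: `(A⁻¹)ᵢᵢ` dominates the reciprocal of `xᵀ A x` for every `x` with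
`xᵢ = 1`. -/
lemma Matrix.PosDef.one_le_inv_diag_mul_quadForm {n : Type*} [Fintype n] [DecidableEq n]
    {A : Matrix n n ℝ} (hA : A.PosDef) (i : n) (x : n → ℝ) (hx : x i = 1) :
    1 ≤ A⁻¹ i i * (x ⬝ᵥ A *ᵥ x) := by
  have ha : 0 < A⁻¹ i i := hA.inv.diag_pos
  have hdet : IsUnit A.det := (Matrix.isUnit_iff_isUnit_det A).mp hA.isUnit
  set a := A⁻¹ i i with ha_def
  set y : n → ℝ := A⁻¹ *ᵥ Pi.single i 1 with hy
  have hyi : y i = a := by simp [hy, ha_def]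
  have hAy : A *ᵥ y = Pi.single i 1 := by
    rw [hy, Matrix.mulVec_mulVec, Matrix.mul_nonsing_inv A hdet, Matrix.one_mulVec]
  have hsymm : y ⬝ᵥ A *ᵥ x = 1 := by
    have hT : Aᵀ = A := by simpa using hA.isHermitian.eq
    rw [Matrix.dotProduct_mulVec, ← Matrix.mulVec_transpose, hT, hAy]
    simp [hx]
  have h0 : 0 ≤ (a • x - y) ⬝ᵥ A *ᵥ (a • x - y) := by
    simpa using hA.posSemidef.dotProduct_mulVec_nonneg (a • x - y)
  have h1 : (a • x - y) ⬝ᵥ A *ᵥ (a • x - y) = a * (a * (x ⬝ᵥ A *ᵥ x) - 1) := by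
    simp only [Matrix.mulVec_sub, Matrix.mulVec_smul, sub_dotProduct, dotProduct_sub,
      smul_dotProduct, dotProduct_smul, hsymm, hAy, smul_eq_mul, dotProduct_single_one,
      Pi.sub_apply, Pi.smul_apply, hx, hyi]
    ring
  rw [h1] at h0
  linarith [nonneg_of_mul_nonneg_right h0 ha]

/-- A form of the inequality between arithmetic and geometric means. -/
lemma Finset.prod_le_one_of_sum_le_card {ι : Type*} (t : Finset ι) (f : ι → ℝ)
    (hf : ∀ i ∈ t, 0 ≤ f i) (hsum : ∑ i ∈ t, f i ≤ t.card) : ∏ i ∈ t, f i ≤ 1 := by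
  calc ∏ i ∈ t, f i ≤ ∏ i ∈ t, Real.exp (f i - 1) :=
        Finset.prod_le_prod hf fun i _ => by linarith [Real.add_one_le_exp (f i - 1)]
    _ = Real.exp (∑ i ∈ t, (f i - 1)) := (Real.exp_sum _ _).symm
    _ ≤ 1 := by
        rw [Real.exp_le_one_iff, Finset.sum_sub_distrib]
        simpa using hsum

namespace ApproxDesign

lemma s_pos {v d : ℕ} (ξ : ApproxDesign v d) (k : Fin d) : 0 < ξ.s k := ξ.blockPos k

lemma sum_s {v d : ℕ} (ξ : ApproxDesign v d) : ∑ k, ξ.s k = 1 := by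
  simp only [s]
  rw [Finset.sum_comm, ξ.sum_one]

lemma quadForm_N {v d : ℕ} (ξ : ApproxDesign v d) (x : Fin v → ℝ) :
    x ⬝ᵥ ξ.N *ᵥ x =
      ∑ k, (∑ i, x i ^ 2 * ξ.w i.succ k - (∑ i, x i * ξ.w i.succ k) ^ 2 / ξ.s k) := by
  have h1 : ∀ i, (ξ.N *ᵥ x) i =
      x i * ξ.r i.succ - ∑ k, ξ.w i.succ k * (∑ j, x j * ξ.w j.succ k) / ξ.s k := by
    intro i
    simp only [Matrix.mulVec, dotProduct, N, Matrix.of_apply, sub_mul, Finset.sum_sub_distrib,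
      ite_mul, zero_mul, Finset.sum_ite_eq, Finset.mem_univ, if_true]
    congr 1
    · ring
    · simp only [Finset.sum_mul, Finset.mul_sum, Finset.sum_div]
      rw [Finset.sum_comm]
      refine Finset.sum_congr rfl fun k _ => Finset.sum_congr rfl fun j _ => by ring
  simp only [dotProduct, h1, mul_sub, Finset.sum_sub_distrib]
  congr 1
  · rw [Finset.sum_comm]
    refine Finset.sum_congr rfl fun i _ => ?_
    rw [r, ← mul_assoc, Finset.mul_sum]
    exact Finset.sum_congr rfl fun k _ => by ring
  · simp only [Finset.mul_sum]
    rw [Finset.sum_comm]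
    refine Finset.sum_congr rfl fun k _ => ?_
    rw [sq, Finset.sum_mul, Finset.sum_div]
    refine Finset.sum_congr rfl fun i _ => ?_
    rw [← Finset.mul_sum]
    ring

/-- The total of the quadratic forms of `N(ξ)` at the normalized columns of the inverse
information matrix of the A-optimal product design. -/
lemma sum_quadForm_N_le {v d : ℕ} (ξ : ApproxDesign v d) (q : ℝ) (hq : 0 < q)
    (hqv : q ^ 2 = v) (x : Fin v → Fin v → ℝ)
    (hx : ∀ j i, x j i = 1 / (q + 1) + if i = j then q / (q + 1) else 0) :
    ∑ j, x j ⬝ᵥ ξ.N *ᵥ x j ≤ v / (q + 1) ^ 2 := by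
  simp only [quadForm_N]
  have hbound : (v : ℝ) / (q + 1) ^ 2 = ∑ k, (v : ℝ) / (q + 1) ^ 2 * ξ.s k := by
    rw [← Finset.mul_sum, ξ.sum_s, mul_one]
  rw [Finset.sum_comm, hbound]
  refine Finset.sum_le_sum fun k _ => ?_
  have hs := ξ.s_pos k
  set σ := ξ.s k
  set w : Fin v → ℝ := fun i => ξ.w i.succ k with hw
  set U := ∑ i, w i with hU
  have hlin : ∀ j, ∑ i, x j i * ξ.w i.succ k = 1 / (q + 1) * U + q / (q + 1) * w j := by
    intro j
    simp [hx, add_mul, Finset.sum_add_distrib, ← Finset.mul_sum, hU, hw]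
  have hsq : ∀ j, ∑ i, x j i ^ 2 * ξ.w i.succ k =
      (1 / (q + 1)) ^ 2 * U + (1 - (1 / (q + 1)) ^ 2) * w j := by
    intro j
    have h : ∀ i, x j i ^ 2 * ξ.w i.succ k = (1 / (q + 1)) ^ 2 * w i +
        if i = j then (1 - (1 / (q + 1)) ^ 2) * w i else 0 := by
      intro i
      rw [hx]
      split_ifs
      · simp only [hw]; field_simp; ring
      · simp [hw]
    simp [h, Finset.sum_add_distrib, ← Finset.mul_sum, hU]
  have hcs : U ^ 2 ≤ q ^ 2 * ∑ j, w j ^ 2 := by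
    rw [hqv]
    simpa using sq_sum_le_card_mul_sum_sq (s := Finset.univ) (f := w)
  set S := ∑ j, w j ^ 2 with hS
  have htot : ∑ j, (∑ i, x j i ^ 2 * ξ.w i.succ k - (∑ i, x j i * ξ.w i.succ k) ^ 2 / σ) =
      (q ^ 2 * (1 / (q + 1)) ^ 2 * U + (1 - (1 / (q + 1)) ^ 2) * U) -
      (q ^ 2 * (1 / (q + 1)) ^ 2 * U ^ 2 + 2 * (1 / (q + 1)) * (q / (q + 1)) * U * U
        + (q / (q + 1)) ^ 2 * S) / σ := by
    have h : ∀ j, (1 / (q + 1) * U + q / (q + 1) * w j) ^ 2 = (1 / (q + 1)) ^ 2 * U ^ 2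
        + 2 * (1 / (q + 1)) * (q / (q + 1)) * U * w j + (q / (q + 1)) ^ 2 * w j ^ 2 := by
      intro j; ring
    simp only [hlin, hsq, Finset.sum_sub_distrib, ← Finset.sum_div, h, Finset.sum_add_distrib,
      ← Finset.mul_sum, ← hU, ← hS, Finset.sum_const, Finset.card_univ, Fintype.card_fin,
      nsmul_eq_mul, hqv]
    ring
  rw [htot, ← hqv, ← sub_nonneg]
  have hid : q ^ 2 / (q + 1) ^ 2 * σ -
      ((q ^ 2 * (1 / (q + 1)) ^ 2 * U + (1 - (1 / (q + 1)) ^ 2) * U) -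
      (q ^ 2 * (1 / (q + 1)) ^ 2 * U ^ 2 + 2 * (1 / (q + 1)) * (q / (q + 1)) * U * U
        + (q / (q + 1)) ^ 2 * S) / σ) =
      ((q * σ - (q + 1) * U) ^ 2 + (q ^ 2 * S - U ^ 2)) / ((q + 1) ^ 2 * σ) := by
    field_simp
    ring
  rw [hid]
  have := sub_nonneg.mpr hcs
  positivity

/-- The product of the diagonal entries of `N(ξ)⁻¹` is at least `(√v + 1) ^ (2 * v)`. -/
lemma le_prod_inv_diag {v d : ℕ} (ξ : ApproxDesign v d) (hξ : ξ.N.PosDef)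
    (q : ℝ) (hq : 0 < q) (hqv : q ^ 2 = v) :
    ∏ _i : Fin v, (q + 1) ^ 2 ≤ ∏ i, ξ.N⁻¹ i i := by
  set x : Fin v → Fin v → ℝ := fun j i => 1 / (q + 1) + if i = j then q / (q + 1) else 0
    with hx
  have hsum := sum_quadForm_N_le ξ q hq hqv x fun _ _ => rfl
  have hone : ∀ i, 1 ≤ ξ.N⁻¹ i i * (x i ⬝ᵥ ξ.N *ᵥ x i) := fun i =>
    hξ.one_le_inv_diag_mul_quadForm i (x i) (by simp only [hx, if_true]; field_simp; ring)
  have ha : ∀ i, 0 < ξ.N⁻¹ i i := fun i => hξ.inv.diag_pos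
  have hb : ∀ i, 0 ≤ x i ⬝ᵥ ξ.N *ᵥ x i := fun i => by
    simpa using hξ.posSemidef.dotProduct_mulVec_nonneg (x i)
  have hamgm : ∏ i, (q + 1) ^ 2 * (x i ⬝ᵥ ξ.N *ᵥ x i) ≤ 1 := by
    refine Finset.prod_le_one_of_sum_le_card _ _ (fun i _ => mul_nonneg (by positivity) (hb i)) ?_
    rw [← Finset.mul_sum, Finset.card_univ, Fintype.card_fin]
    rw [le_div_iff₀ (by positivity)] at hsum
    linarith
  have hP : 0 < ∏ i, ξ.N⁻¹ i i := Finset.prod_pos fun i _ => ha i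
  calc ∏ _i : Fin v, (q + 1) ^ 2
      ≤ ∏ i, ξ.N⁻¹ i i * ((q + 1) ^ 2 * (x i ⬝ᵥ ξ.N *ᵥ x i)) := by
        refine Finset.prod_le_prod (fun i _ => by positivity) fun i _ => ?_
        nlinarith [hone i, sq_nonneg (q + 1)]
    _ = (∏ i, ξ.N⁻¹ i i) * ∏ i, (q + 1) ^ 2 * (x i ⬝ᵥ ξ.N *ᵥ x i) := Finset.prod_mul_distrib
    _ ≤ ∏ i, ξ.N⁻¹ i i := mul_le_of_le_one_right hP.le hamgm

end ApproxDesign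

/-- The A-optimal product design, with control weight `1/(√v+1)` and
test-treatment weights `1/(√v(√v+1))`, is also R-optimal: it minimizes the product of
the diagonal entries of `N(ξ)⁻¹` over all feasible approximate block designs. -/
theorem Aopt_is_Ropt {v d : ℕ} (hv : 2 ≤ v) (hd : 1 ≤ d)
    (s : Fin d → ℝ) (hs : ∀ k, 0 < s k) (hsum : ∑ k, s k = 1)
    (ξs : ApproxDesign v d)
    (hξ : ∀ i k, ξs.w i k =
      (if i = 0 then 1 / (Real.sqrt v + 1)
        else 1 / (Real.sqrt v * (Real.sqrt v + 1))) * s k) :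
    (ApproxDesign.N ξs).PosDef ∧
    ∀ ξ : ApproxDesign v d, (ApproxDesign.N ξ).PosDef →
      ∏ i, (ApproxDesign.N ξs)⁻¹ i i ≤ ∏ i, (ApproxDesign.N ξ)⁻¹ i i := by
  have hq : 0 < Real.sqrt v := Real.sqrt_pos.mpr (by positivity)
  have hqv : Real.sqrt v ^ 2 = v := Real.sq_sqrt (Nat.cast_nonneg v)
  set q := Real.sqrt v
  set ρ := 1 / (q * (q + 1)) with hρ
  have hρ0 : 0 < ρ := by positivity
  have hw : ∀ (i : Fin v) k, ξs.w i.succ k = ρ * s k := fun i k => by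
    rw [hξ, if_neg (Fin.succ_ne_zero i)]
  have hsk : ∀ k, ξs.s k = s k := by
    intro k
    rw [ApproxDesign.s, Fin.sum_univ_succ]
    simp only [hw, hξ 0 k, if_true, Finset.sum_const, Finset.card_univ, Fintype.card_fin,
      nsmul_eq_mul, ← hqv, hρ]
    field_simp
    ring
  have hN : ξs.N = ρ • (1 : Matrix (Fin v) (Fin v) ℝ) - ρ ^ 2 • Matrix.of fun _ _ => 1 := by
    ext i j
    have h1 : ξs.r i.succ = ρ := by simp [ApproxDesign.r, hw, ← Finset.mul_sum, hsum]
    have h2 : ∑ k, ξs.w i.succ k * ξs.w j.succ k / ξs.s k = ρ ^ 2 := by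
      rw [← mul_one (ρ ^ 2), ← hsum, Finset.mul_sum]
      refine Finset.sum_congr rfl fun k _ => ?_
      have := (hs k).ne'
      rw [hw, hw, hsk]
      field_simp
    simp [ApproxDesign.N, h1, h2, Matrix.one_apply]
  have hρv : 0 < 1 - ρ * q ^ 2 := by
    have : 1 - ρ * q ^ 2 = 1 / (q + 1) := by rw [hρ]; field_simp; ring
    rw [this]; positivity
  have hpd : ξs.N.PosDef := by
    refine Matrix.PosDef.of_dotProduct_mulVec_pos ?_ fun x hx => ?_
    · ext i j
      simp [hN, Matrix.one_apply, eq_comm]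
    · have hform : star x ⬝ᵥ ξs.N *ᵥ x = ρ * ∑ i, x i ^ 2 - ρ ^ 2 * (∑ i, x i) ^ 2 := by
        rw [star_trivial, ApproxDesign.quadForm_N]
        have hk : ∀ k, ∑ i, x i ^ 2 * ξs.w i.succ k - (∑ i, x i * ξs.w i.succ k) ^ 2 / ξs.s k
            = (ρ * ∑ i, x i ^ 2 - ρ ^ 2 * (∑ i, x i) ^ 2) * s k := by
          intro k
          have := (hs k).ne'
          simp only [hw, hsk, ← Finset.sum_mul]
          field_simp
        simp only [hk]
        rw [← Finset.mul_sum, hsum, mul_one]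
      rw [hform]
      have hcs : (∑ i, x i) ^ 2 ≤ q ^ 2 * ∑ i, x i ^ 2 := by
        rw [hqv]
        simpa using sq_sum_le_card_mul_sum_sq (s := Finset.univ) (f := x)
      have hpos : 0 < ∑ i, x i ^ 2 := by
        obtain ⟨i, hi⟩ := Function.ne_iff.mp hx
        exact Finset.sum_pos' (fun _ _ => sq_nonneg _)
          ⟨i, Finset.mem_univ i, by simpa using sq_pos_of_ne_zero hi⟩
      have h1 := mul_le_mul_of_nonneg_left hcs (sq_nonneg ρ)
      have h2 := mul_pos (mul_pos hρ0 hρv) hpos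
      linarith
  refine ⟨hpd, fun ξ hξpd => ?_⟩
  have hinv : ξs.N⁻¹ = (q * (q + 1)) • (1 : Matrix (Fin v) (Fin v) ℝ) +
      (q + 1) • Matrix.of fun _ _ => 1 := by
    refine Matrix.inv_eq_right_inv ?_
    have hJ : (Matrix.of fun _ _ => 1 : Matrix (Fin v) (Fin v) ℝ) * Matrix.of (fun _ _ => 1) =
        q ^ 2 • Matrix.of fun _ _ => 1 := by
      ext i j
      simp [Matrix.mul_apply, hqv]
    rw [hN]
    simp only [sub_mul, mul_add, smul_mul_assoc, mul_smul_comm, one_mul, mul_one, hJ]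
    ext i j
    simp only [Matrix.sub_apply, Matrix.add_apply, Matrix.smul_apply, Matrix.of_apply,
      smul_eq_mul, hρ]
    field_simp
    ring
  have hdiag : ∀ i, ξs.N⁻¹ i i = (q + 1) ^ 2 := fun i => by
    simp [hinv]; ring
  simp only [hdiag]
  exact ξ.le_prod_inv_diag hξpd q hq hqv
end
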